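/- Let n ∈ ℕ and let (M, f, s, mx, le, zero) be an interpretation satisfying the NiA clause set C(n). Then for every a : M and every i ≤ n, f a ≠ num i. (Semantic content of: the clauses f(x) = 0 ⊢, …, f(x) = n ⊢ are derivable by resolution from C(n).) -/

import Mathlib

/-- Numerals in the interpretation: `num 0 = zero`, `num (k+1) = s (num k)`. -/
def num {M : Type*} (s : M → M) (zero : M) : ℕ → M
  | 0 => zero
  | k + 1 => s (num s zero k)

/-- A chain in which each term bounds, under `le`, the successors of all earlier terms. -/
def succMaxChain {M : Type*} (s : M → M) (mx : M → M → M) (a : M) : ℕ → M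
  | 0 => a
  | j + 1 => mx (s (succMaxChain s mx a j)) (succMaxChain s mx a j)

theorem le_succ_succMaxChain_of_lt {M : Type*} {s : M → M} {mx : M → M → M} {le : M → M → Prop}
    (hleft : ∀ a b c, le (mx a b) c → le a c) (hright : ∀ a b c, le (mx a b) c → le b c)
    (a : M) {i j : ℕ} (hij : i < j) {c : M} (h : le (succMaxChain s mx a j) c) :
    le (s (succMaxChain s mx a i)) c := by
  induction j with
  | zero => omega
  | succ j ih =>
    rcases Nat.lt_succ_iff_lt_or_eq.mp hij with hlt | rfl
    · exact ih hlt (hright _ _ _ h)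
    · exact hleft _ _ _ h

theorem stmt12 {M : Type*} (n : ℕ) (f s : M → M) (mx : M → M → M)
    (le : M → M → Prop) (zero : M)
    (hC1 : ∀ a, le a a)
    (hC2 : ∀ a b c, le (mx a b) c → le a c)
    (hC3 : ∀ a b c, le (mx a b) c → le b c)
    (hC4 : ∀ k ≤ n, ∀ a b, ¬ (f b = num s zero k ∧ f a = num s zero k ∧ le (s b) a))
    (hC5 : ∀ a, ∃ i ≤ n, f a = num s zero i) :
    ∀ (a : M), ∀ i ≤ n, f a ≠ num s zero i := by
  intro a
  exfalso
  choose g hg hfg using fun j => hC5 (succMaxChain s mx a j)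
  have not_lt {i j : ℕ} (h : g i = g j) : ¬ i < j := fun hij =>
    hC4 (g i) (hg i) (succMaxChain s mx a j) (succMaxChain s mx a i)
      ⟨hfg i, h ▸ hfg j, le_succ_succMaxChain_of_lt hC2 hC3 a hij (hC1 _)⟩
  obtain ⟨i, -, j, -, hne, h⟩ := Finset.exists_ne_map_eq_of_card_lt_of_maps_to
    (s := Finset.range (n + 2)) (t := Finset.range (n + 1)) (f := g) (by simp)
    (fun j _ => Finset.mem_coe.mpr (Finset.mem_range.mpr (Nat.lt_succ_of_le (hg j))))
  exact hne.lt_or_gt.elim (not_lt h) (not_lt h.symm)
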